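/- If $G$ is a connected 5-cyclic graph of order $n$ (i.e., $|E(G)| = n + 4$), then $rx_3(G) = n - 2$ if and only if $G = K_5 - e$. -/

import Mathlib

open SimpleGraph

/-- An edge-coloring `c` is a `k`-rainbow coloring of `G` if every `k`-set of vertices
is contained in a rainbow tree: a subgraph of `G` that is a tree, contains the `k` vertices,
and whose edges receive pairwise distinct colors. -/
def IsRainbowColoring {V : Type*} [Fintype V] (G : SimpleGraph V) {α : Type*}
    (c : Sym2 V → α) (k : ℕ) : Prop :=
  ∀ S : Finset V, S.card = k →
    ∃ T : G.Subgraph, (↑S : Set V) ⊆ T.verts ∧ T.coe.IsTree ∧ Set.InjOn c T.edgeSet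

/-- The `k`-rainbow index of `G`: the minimum number of colors in a `k`-rainbow coloring. -/
noncomputable def rxk {V : Type*} [Fintype V] (G : SimpleGraph V) (k : ℕ) : ℕ :=
  sInf {q | ∃ c : Sym2 V → Fin q, IsRainbowColoring G c k}

/-- `K₅ - e`: the complete graph on 5 vertices minus one edge. -/
def K5MinusE : SimpleGraph (Fin 5) :=
  (completeGraph (Fin 5)).deleteEdges {s(0, 1)}

/-- The set `S` lies in one component of a subgraph of `G` whose edges have distinct colors. -/
def RainbowLinked {V α : Type*} (G : SimpleGraph V) (c : Sym2 V → α) (S : Finset V) : Prop :=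
  ∃ R ≤ G, Set.InjOn c R.edgeSet ∧ ∀ x ∈ S, ∀ y ∈ S, R.Reachable x y

/-- `G` has a 3-rainbow coloring with three colors fewer than it has vertices. -/
def SavesThree {V : Type*} (G : SimpleGraph V) : Prop :=
  ∃ c : Sym2 V → ℕ, (∀ e, c e + 3 < Nat.card V) ∧
    ∀ S : Finset V, S.card = 3 → RainbowLinked G c S

theorem RainbowLinked.exists_tree {V α : Type*} {G : SimpleGraph V} {c : Sym2 V → α}
    {S : Finset V} (h : RainbowLinked G c S) (hS : S.Nonempty) :
    ∃ T : G.Subgraph, (↑S : Set V) ⊆ T.verts ∧ T.coe.IsTree ∧ Set.InjOn c T.edgeSet := by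
  obtain ⟨R, hRG, hc, hR⟩ := h
  obtain ⟨a, ha⟩ := hS
  obtain ⟨F, hF, hFtree⟩ :=
    (R.connectedComponentMk a).connected_toSimpleGraph.exists_isTree_le
  have hadj : ∀ x y, F.Adj x y → R.Adj x y := fun x y hxy => hF hxy
  let T : G.Subgraph :=
    { verts := (R.connectedComponentMk a).supp
      Adj := fun x y => ∃ hx hy, F.Adj ⟨x, hx⟩ ⟨y, hy⟩
      adj_sub := fun ⟨_, _, h⟩ => hRG (hadj _ _ h)
      edge_vert := fun ⟨hx, _, _⟩ => hx
      symm := ⟨fun _ _ ⟨hx, hy, h⟩ => ⟨hy, hx, h.symm⟩⟩ }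
  have hT : T.coe = F := by
    ext x y
    exact ⟨fun ⟨_, _, h⟩ => h, fun h => ⟨x.2, y.2, h⟩⟩
  refine ⟨T, fun x hx => ?_, hT ▸ hFtree, hc.mono fun e => ?_⟩
  · exact ConnectedComponent.sound (hR x hx a ha)
  · induction e with
    | _ x y => exact fun ⟨_, _, h⟩ => hadj _ _ h

theorem SavesThree.rxk_le {V : Type*} [Fintype V] {G : SimpleGraph V} (h : SavesThree G) :
    rxk G 3 ≤ Fintype.card V - 3 := by
  obtain ⟨c, hc, hS⟩ := h
  refine Nat.sInf_le ⟨fun e => ⟨c e, ?_⟩, fun S hcard => ?_⟩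
  · have := hc e
    rw [Nat.card_eq_fintype_card] at this
    omega
  · obtain ⟨T, hST, hT, hinj⟩ := (hS S hcard).exists_tree (Finset.card_pos.1 (by omega))
    exact ⟨T, hST, hT, fun e he e' he' hcol => hinj he he' (Fin.ext_iff.1 hcol)⟩

/-- The simple graph obtained by identifying vertices along `φ`. -/
def quotientGraph {V W : Type*} (G : SimpleGraph V) (φ : V → W) : SimpleGraph W where
  Adj x y := x ≠ y ∧ ∃ a b, φ a = x ∧ φ b = y ∧ G.Adj a b
  symm := ⟨fun _ _ ⟨hne, a, b, ha, hb, h⟩ => ⟨hne.symm, b, a, hb, ha, h.symm⟩⟩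
  loopless := ⟨fun _ h => h.1 rfl⟩

theorem quotientGraph_connected {V W : Type*} {G : SimpleGraph V} {φ : V → W}
    (hG : G.Connected) (hφ : Function.Surjective φ) : (quotientGraph G φ).Connected := by
  have : Nonempty W := hG.nonempty.map φ
  refine ⟨fun x y => ?_⟩
  obtain ⟨a, rfl⟩ := hφ x
  obtain ⟨b, rfl⟩ := hφ y
  obtain ⟨p⟩ := hG.preconnected a b
  induction p with
  | nil => rfl
  | @cons u v w h _ ih =>
    refine Reachable.trans ?_ ih
    by_cases huv : φ u = φ v
    · rw [huv]
    · exact Adj.reachable (show (quotientGraph G φ).Adj _ _ from ⟨huv, u, v, rfl, rfl, h⟩)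

/-- Contracting a single edge loses at most one color of savings: give that edge a new color. -/
theorem SavesThree.of_quotientGraph {V W : Type*} [Finite V] {G : SimpleGraph V} {φ : V → W}
    {u v : V} (huv : G.Adj u v) (hcard : Nat.card V = Nat.card W + 1) (hW : 3 ≤ Nat.card W)
    (hφ : ∀ a b, φ a = φ b → a = b ∨ s(a, b) = s(u, v)) (h : SavesThree (quotientGraph G φ)) :
    SavesThree G := by
  classical
  obtain ⟨c, hc, hS⟩ := h
  have : Finite W := Nat.finite_of_card_ne_zero (by omega)
  have := Fintype.ofFinite W
  refine ⟨fun e => if e = s(u, v) then Nat.card W - 3 else c (e.map φ), fun e => ?_, ?_⟩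
  · have := hc (e.map φ)
    dsimp only
    split_ifs <;> omega
  intro S hScard
  obtain ⟨S', hSS', hS'card⟩ : ∃ S' : Finset W, S.image φ ⊆ S' ∧ S'.card = 3 :=
    Finset.exists_superset_card_eq (hScard ▸ Finset.card_image_le)
      (by rwa [← Nat.card_eq_fintype_card])
  obtain ⟨R, hRG, hRc, hR⟩ := hS S' hS'card
  have hlift : ∀ e : R.edgeSet, ∃ e' ∈ G.edgeSet, Sym2.map φ e' = e := by
    rintro ⟨e, he⟩
    induction e with
    | _ x y =>
      obtain ⟨_, a, b, rfl, rfl, h⟩ := hRG he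
      exact ⟨s(a, b), h, rfl⟩
  choose lift hliftG hliftφ using hlift
  let Q : SimpleGraph V := fromEdgeSet (insert s(u, v) (Set.range lift))
  have hQ : Q.edgeSet ⊆ insert s(u, v) (Set.range lift) := by
    simp only [Q, edgeSet_fromEdgeSet]
    exact Set.sdiff_subset
  have hfiber : ∀ a b, φ a = φ b → Q.Reachable a b := by
    intro a b hab
    have huvQ : Q.Adj u v := by simp [Q, huv.ne]
    obtain rfl | hab := hφ a b hab
    · rfl
    · obtain ⟨rfl, rfl⟩ | ⟨rfl, rfl⟩ := Sym2.eq_iff.1 hab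
      · exact huvQ.reachable
      · exact huvQ.symm.reachable
  have hwalk : ∀ x y, R.Reachable x y → ∀ a b, φ a = x → φ b = y → Q.Reachable a b := by
    rintro x y ⟨p⟩
    induction p with
    | nil => rintro a b rfl hb; exact hfiber a b hb.symm
    | @cons x y z hxy _ ih =>
      rintro a b rfl rfl
      obtain ⟨a', b', hab'⟩ : ∃ a' b', lift ⟨s(φ a, y), hxy⟩ = s(a', b') :=
        ⟨_, _, (Quot.out_eq (lift ⟨s(φ a, y), hxy⟩)).symm⟩
      have hφab : s(φ a', φ b') = s(φ a, y) := by
        have := hliftφ ⟨s(φ a, y), hxy⟩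
        rwa [hab'] at this
      have hadj : G.Adj a' b' := by
        have := hliftG ⟨s(φ a, y), hxy⟩
        rwa [hab'] at this
      have hQadj : Q.Adj a' b' := by
        simp only [Q, fromEdgeSet_adj]
        exact ⟨Or.inr ⟨_, hab'⟩, hadj.ne⟩
      obtain ⟨ha', hb'⟩ | ⟨ha', hb'⟩ := Sym2.eq_iff.1 hφab
      · exact ((hfiber a a' ha'.symm).trans hQadj.reachable).trans (ih b' b hb' rfl)
      · exact ((hfiber a b' hb'.symm).trans hQadj.symm.reachable).trans (ih a' b ha' rfl)
  refine ⟨Q, fun a b hab => ?_, ?_, fun x hx y hy => ?_⟩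
  · rcases hQ (Q.mem_edgeSet.2 hab) with h | ⟨e, h⟩
    · obtain ⟨rfl, rfl⟩ | ⟨rfl, rfl⟩ := Sym2.eq_iff.1 h
      exacts [huv, huv.symm]
    · have := hliftG e
      rwa [h] at this
  · intro e he e' he' hee'
    have key : ∀ e ∈ Q.edgeSet, e ≠ s(u, v) → ∃ f, lift f = e := fun e he hne =>
      (hQ he).resolve_left hne
    dsimp only at hee'
    have hlt := fun e => hc (Sym2.map φ e)
    split_ifs at hee' with h1 h2 h2
    · rw [h1, h2]
    · have := hlt e'; omega
    · have := hlt e; omega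
    · obtain ⟨f, rfl⟩ := key e he h1
      obtain ⟨f', rfl⟩ := key e' he' h2
      rw [hliftφ, hliftφ] at hee'
      rw [Subtype.ext (hRc f.2 f'.2 hee')]
  · exact hwalk _ _ (hR _ (hSS' (Finset.mem_image_of_mem φ hx)) _
      (hSS' (Finset.mem_image_of_mem φ hy))) x y rfl rfl

/-- Send `v` to `u` and fix every other vertex. -/
noncomputable def mergeInto {V : Type*} (u v : V) (huv : u ≠ v) (x : V) : {x : V // x ≠ v} :=
  open Classical in if h : x = v then ⟨u, huv⟩ else ⟨x, h⟩

section mergeInto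

variable {V : Type*} {u v : V} (huv : u ≠ v)

theorem mergeInto_self : mergeInto u v huv v = ⟨u, huv⟩ := dif_pos rfl

theorem mergeInto_of_ne {x : V} (h : x ≠ v) : mergeInto u v huv x = ⟨x, h⟩ := dif_neg h

theorem mergeInto_surjective : Function.Surjective (mergeInto u v huv) :=
  fun x => ⟨x, mergeInto_of_ne huv x.2⟩

theorem mergeInto_eq {a b : V} (h : mergeInto u v huv a = mergeInto u v huv b) :
    a = b ∨ s(a, b) = s(u, v) := by
  by_cases ha : a = v <;> by_cases hb : b = v
  · exact Or.inl (ha.trans hb.symm)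
  · subst ha
    rw [mergeInto_self, mergeInto_of_ne huv hb, Subtype.mk.injEq] at h
    exact Or.inr (by rw [h, Sym2.eq_swap])
  · subst hb
    rw [mergeInto_self, mergeInto_of_ne huv ha, Subtype.mk.injEq] at h
    exact Or.inr (by rw [h])
  · rw [mergeInto_of_ne huv hb, mergeInto_of_ne huv ha, Subtype.mk.injEq] at h
    exact Or.inl h

theorem card_eq_card_ne_add_one [Finite V] (v : V) :
    Nat.card V = Nat.card {x : V // x ≠ v} + 1 := by
  classical
  have := Fintype.ofFinite V
  rw [Nat.card_eq_fintype_card, Nat.card_eq_fintype_card, Fintype.card_subtype_compl,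
    Fintype.card_subtype_eq]
  have := Fintype.card_pos_iff.2 ⟨v⟩
  omega

/-- Contracting an edge that lies in no triangle destroys no other edge. -/
theorem ncard_edgeSet_le_quotientGraph [Finite V] {G : SimpleGraph V}
    (htri : ∀ w, G.Adj u w → ¬ G.Adj v w) :
    G.edgeSet.ncard ≤ (quotientGraph G (mergeInto u v huv)).edgeSet.ncard + 1 := by
  have hinj : Set.InjOn (Sym2.map (mergeInto u v huv)) (G.edgeSet \ {s(u, v)}) := by
    rintro e ⟨he, hne⟩ e' ⟨he', hne'⟩ hee'
    induction e with | _ a b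
    induction e' with | _ a' b'
    rw [Set.mem_singleton_iff] at hne hne'
    rw [mem_edgeSet] at he he'
    rw [Sym2.map_mk, Sym2.map_mk] at hee'
    wlog h : mergeInto u v huv a = mergeInto u v huv a' ∧
      mergeInto u v huv b = mergeInto u v huv b' generalizing a' b'
    · rw [Sym2.eq_swap (a := a')]
      exact this b' a' he'.symm (by rwa [Sym2.eq_swap]) (by rw [hee', Sym2.eq_swap])
        ((Sym2.eq_iff.1 hee').resolve_left h)
    have hcase := mergeInto_eq huv h.1
    have hcase' := mergeInto_eq huv h.2
    simp only [Sym2.eq_iff] at hcase hcase' hne hne' ⊢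
    grind [SimpleGraph.Adj.symm, SimpleGraph.Adj.ne]
  have hmaps : Set.MapsTo (Sym2.map (mergeInto u v huv)) (G.edgeSet \ {s(u, v)})
      (quotientGraph G (mergeInto u v huv)).edgeSet := by
    rintro e ⟨he, hne⟩
    induction e with | _ a b
    rw [mem_edgeSet] at he
    refine (mem_edgeSet _).2 ⟨fun h => ?_, a, b, rfl, rfl, he⟩
    exact (mergeInto_eq huv h).elim he.ne hne
  have h1 := Set.ncard_le_ncard_of_injOn _ hmaps hinj (Set.toFinite _)
  have h2 := Set.ncard_le_ncard_sdiff_add_ncard G.edgeSet {s(u, v)}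
  rw [Set.ncard_singleton] at h2
  omega

end mergeInto

/-- `G` contains a copy of the graph on `0, …, k - 1` with edge list `L`. -/
def Embeds {V : Type*} (G : SimpleGraph V) (k : ℕ) (L : List (ℕ × ℕ)) : Prop :=
  ∃ f : ℕ → V, Set.InjOn f (Set.Iio k) ∧ ∀ p ∈ L, p.1 < k ∧ p.2 < k ∧ G.Adj (f p.1) (f p.2)

theorem SimpleGraph.Connected.exists_adj_notMem {V : Type*} {G : SimpleGraph V}
    (hG : G.Connected) {s : Set V} (hs : s.Nonempty) (hs' : s ≠ Set.univ) :
    ∃ x ∈ s, ∃ y ∉ s, G.Adj x y := by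
  obtain ⟨x, hx⟩ := hs
  obtain ⟨y, hy⟩ := (Set.ne_univ_iff_exists_notMem s).1 hs'
  obtain ⟨p⟩ := hG.preconnected x y
  obtain ⟨d, -, hd, hd'⟩ := p.exists_boundary_dart s hx hy
  exact ⟨_, hd, _, hd', d.adj⟩

theorem exists_adj_notMem_image {V : Type*} [Finite V] {G : SimpleGraph V} (hG : G.Connected)
    (f : ℕ → V) {k : ℕ} (hk : 0 < k) (hcard : k < Nat.card V) :
    ∃ i < k, ∃ y, (∀ j < k, f j ≠ y) ∧ G.Adj (f i) y := by
  obtain ⟨_, ⟨i, hi, rfl⟩, y, hy, hadj⟩ :=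
    hG.exists_adj_notMem (s := f '' Set.Iio k) ⟨f 0, 0, hk, rfl⟩ fun h => by
      have hle := Set.ncard_image_le (f := f) (Set.finite_Iio k)
      rw [h, Set.ncard_univ, Set.ncard_Iio_nat] at hle
      omega
  exact ⟨i, hi, y, fun j hj h => hy ⟨j, hj, h⟩, hadj⟩

/-- A copy of a pattern survives contracting everything outside it, so it suffices to
treat spanning copies. -/
theorem SavesThree.of_embeds.{u} {k : ℕ} {L : List (ℕ × ℕ)} (hk : 3 ≤ k)
    (hspan : ∀ {V : Type u} [Finite V] {G : SimpleGraph V}, Nat.card V = k → Embeds G k L →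
      SavesThree G)
    {V : Type u} [Finite V] {G : SimpleGraph V} (hG : G.Connected) (h : Embeds G k L) :
    SavesThree G := by
  obtain ⟨n, hn⟩ : ∃ n, Nat.card V = n := ⟨_, rfl⟩
  induction n using Nat.strong_induction_on generalizing V with
  | _ n ih =>
  obtain ⟨f, hf, hL⟩ := h
  have hle : k ≤ Nat.card V := by
    have := Set.ncard_le_card (f '' Set.Iio k)
    rwa [hf.ncard_image, Set.ncard_Iio_nat] at this
  obtain hlt | heq := hle.lt_or_eq
  · obtain ⟨i, hi, v, hv, hadj⟩ := exists_adj_notMem_image hG f (by omega) hlt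
    have hcard := card_eq_card_ne_add_one v
    refine SavesThree.of_quotientGraph hadj hcard (by omega)
      (fun a b => mergeInto_eq hadj.ne) ?_
    refine ih _ (by omega) (quotientGraph_connected hG (mergeInto_surjective hadj.ne))
      ⟨fun j => mergeInto (f i) v hadj.ne (f j), ?_, ?_⟩ rfl
    · intro j hj j' hj' h
      dsimp only at h
      rw [mergeInto_of_ne _ (hv j hj), mergeInto_of_ne _ (hv j' hj'), Subtype.mk.injEq] at h
      exact hf hj hj' h
    · intro p hp
      obtain ⟨h1, h2, h3⟩ := hL p hp
      refine ⟨h1, h2, fun h => h3.ne ?_, _, _, rfl, rfl, h3⟩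
      dsimp only at h
      rwa [mergeInto_of_ne _ (hv _ h1), mergeInto_of_ne _ (hv _ h2), Subtype.mk.injEq] at h
  · exact hspan heq.symm ⟨f, hf, hL⟩

/-- Whether the edge list `L` joins `i` and `j`, in either order. -/
def hasEdge (L : List (ℕ × ℕ)) (i j : ℕ) : Bool :=
  L.any fun p => (Nat.beq p.1 i && Nat.beq p.2 j) || (Nat.beq p.1 j && Nat.beq p.2 i)

theorem hasEdge_iff {L : List (ℕ × ℕ)} {i j : ℕ} :
    hasEdge L i j = true ↔ (i, j) ∈ L ∨ (j, i) ∈ L := by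
  simp only [hasEdge, List.any_eq_true, Bool.or_eq_true, Bool.and_eq_true, Nat.beq_eq,
    Prod.exists]
  constructor
  · rintro ⟨a, b, h, ⟨rfl, rfl⟩ | ⟨rfl, rfl⟩⟩
    exacts [Or.inl h, Or.inr h]
  · rintro (h | h)
    exacts [⟨_, _, h, Or.inl ⟨rfl, rfl⟩⟩, ⟨_, _, h, Or.inr ⟨rfl, rfl⟩⟩]

theorem hasEdge_comm (L : List (ℕ × ℕ)) (i j : ℕ) : hasEdge L i j = hasEdge L j i := by
  rw [Bool.eq_iff_iff, hasEdge_iff, hasEdge_iff, or_comm]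

/-- One pass over the edge list `T`, adding every vertex joined to one already in `vis`. -/
def spread (T : List (ℕ × ℕ)) (vis : List ℕ) : List ℕ :=
  T.foldl (fun vis p => if p.1 ∈ vis then (if p.2 ∈ vis then vis else p.2 :: vis)
    else if p.2 ∈ vis then p.1 :: vis else vis) vis

theorem reachable_of_mem_spread {V : Type*} {R : SimpleGraph V} {f : ℕ → V} {r : V}
    {T : List (ℕ × ℕ)} (hT : ∀ p ∈ T, R.Adj (f p.1) (f p.2)) {vis : List ℕ}
    (hvis : ∀ x ∈ vis, R.Reachable r (f x)) : ∀ x ∈ spread T vis, R.Reachable r (f x) := by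
  induction T generalizing vis with
  | nil => exact hvis
  | cons p T ih =>
    refine ih (fun q hq => hT q (List.mem_cons_of_mem _ hq)) ?_
    have hp := (hT p List.mem_cons_self).reachable
    dsimp only
    split_ifs with h1 h2 h2
    · exact hvis
    · exact List.forall_mem_cons.2 ⟨(hvis _ h1).trans hp, hvis⟩
    · exact List.forall_mem_cons.2 ⟨(hvis _ h2).trans hp.symm, hvis⟩
    · exact hvis

/-- An edge-colored graph on `0, …, size - 1`, given by its color classes. -/
structure Pattern where
  size : ℕ
  classes : List (List (ℕ × ℕ))

/-- All edges of a pattern. -/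
def Pattern.edges (P : Pattern) : List (ℕ × ℕ) := P.classes.flatten

/-- Some choice of one edge from every color class connects `a`, `b` and `d`. -/
def Pattern.Links (P : Pattern) (a b d : ℕ) : Prop :=
  ∃ T ∈ P.classes.sections, b ∈ (spread T)^[T.length] [a] ∧ d ∈ (spread T)^[T.length] [a]

instance (P : Pattern) (a b d : ℕ) : Decidable (P.Links a b d) :=
  inferInstanceAs (Decidable (∃ T ∈ P.classes.sections, _ ∧ _))

/-- The coloring uses three colors fewer than there are vertices, its classes are disjoint, and
any three vertices are linked. -/
def Pattern.Valid (P : Pattern) : Prop :=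
  P.classes.length + 3 = P.size ∧ 0 < P.classes.length ∧
  (∀ i < P.classes.length, ∀ p ∈ P.classes.getD i [],
    P.classes.findIdx (hasEdge · p.1 p.2) = i) ∧
  ∀ d < P.size, ∀ b < d, ∀ a < b, P.Links a b d

instance (P : Pattern) : Decidable P.Valid :=
  inferInstanceAs (Decidable (_ ∧ _ ∧ _ ∧ _))

theorem Finset.exists_sorted_of_card_eq_three {S : Finset ℕ} (h : S.card = 3) :
    ∃ a b d, a < b ∧ b < d ∧ S = {a, b, d} := by
  obtain ⟨x, y, z, hxy, hxz, hyz, rfl⟩ := Finset.card_eq_three.1 h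
  rcases lt_or_gt_of_ne hxy with h1 | h1 <;> rcases lt_or_gt_of_ne hxz with h2 | h2 <;>
    rcases lt_or_gt_of_ne hyz with h3 | h3
  · exact ⟨x, y, z, h1, h3, rfl⟩
  · exact ⟨x, z, y, h2, h3, by grind⟩
  · omega
  · exact ⟨z, x, y, h2, h1, by grind⟩
  · exact ⟨y, x, z, h1, h2, by grind⟩
  · omega
  · exact ⟨y, z, x, h3, h2, by grind⟩
  · exact ⟨z, y, x, h3, h1, by grind⟩

theorem Pattern.Valid.savesThree_of_card {P : Pattern} (hP : P.Valid) {V : Type*} [Finite V]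
    {G : SimpleGraph V} (hcard : Nat.card V = P.size) (h : Embeds G P.size P.edges) :
    SavesThree G := by
  classical
  obtain ⟨hlen, hpos, hclass, htriple⟩ := hP
  obtain ⟨f, hf, hL⟩ := h
  have hsurj : ∀ x, ∃ i < P.size, f i = x := by
    have himage : f '' Set.Iio P.size = Set.univ := by
      refine Set.eq_of_subset_of_ncard_le (Set.subset_univ _) ?_ (Set.toFinite _)
      rw [hf.ncard_image, Set.ncard_Iio_nat, Set.ncard_univ, hcard]
    intro x
    obtain ⟨i, hi, h⟩ := himage.symm ▸ Set.mem_univ x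
    exact ⟨i, hi, h⟩
  choose g hg hfg using hsurj
  have hgf : ∀ i < P.size, g (f i) = i := fun i hi => hf (hg _) hi (hfg _)
  let c : Sym2 V → ℕ := Sym2.lift ⟨fun x y =>
    P.classes.findIdx (hasEdge · (g x) (g y)) % P.classes.length, fun x y => by
      simp only [hasEdge_comm _ (g x)]⟩
  refine ⟨c, fun e => ?_, fun S hS => ?_⟩
  · induction e with | _ x y
    have : c s(x, y) < P.classes.length := Nat.mod_lt _ hpos
    omega
  obtain ⟨a, b, d, hab, hbd, hSeq⟩ : ∃ a b d, a < b ∧ b < d ∧ S.image g = {a, b, d} :=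
    Finset.exists_sorted_of_card_eq_three (by
      rw [Finset.card_image_of_injective S (Function.LeftInverse.injective hfg), hS])
  have hd : d < P.size := by
    obtain ⟨x, -, rfl⟩ := Finset.mem_image.1 (show d ∈ S.image g by simp [hSeq])
    exact hg x
  obtain ⟨T, hT, hb', hd'⟩ := htriple d hd b hbd a hab
  rw [List.mem_sections, List.forall₂_iff_get] at hT
  have hcolor : ∀ i (hi : i < T.length), T[i] ∈ P.edges ∧ c s(f T[i].1, f T[i].2) = i := by
    intro i hi
    have hi' : i < P.classes.length := hT.1 ▸ hi
    have hmem : T[i] ∈ P.classes[i] := hT.2 i hi hi'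
    have hedge : T[i] ∈ P.edges := List.mem_flatten.2 ⟨_, List.getElem_mem hi', hmem⟩
    refine ⟨hedge, ?_⟩
    have hidx := hclass i hi' T[i] (by rwa [List.getD_eq_getElem _ _ hi'])
    change P.classes.findIdx (hasEdge · (g _) (g _)) % _ = i
    rw [hgf _ (hL _ hedge).1, hgf _ (hL _ hedge).2.1, hidx, Nat.mod_eq_of_lt hi']
  let R : SimpleGraph V := fromEdgeSet {e | ∃ p ∈ T, e = s(f p.1, f p.2)}
  have hTG : ∀ p ∈ T, G.Adj (f p.1) (f p.2) := by
    intro p hp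
    obtain ⟨i, hi, rfl⟩ := List.mem_iff_getElem.1 hp
    exact (hL _ (hcolor i hi).1).2.2
  have hTR : ∀ p ∈ T, R.Adj (f p.1) (f p.2) := fun p hp =>
    (fromEdgeSet_adj _).2 ⟨⟨p, hp, rfl⟩, (hTG p hp).ne⟩
  have hRT : ∀ e ∈ R.edgeSet, ∃ p ∈ T, e = s(f p.1, f p.2) := fun e he => by
    rw [edgeSet_fromEdgeSet] at he
    exact he.1
  refine ⟨R, fun x y hxy => ?_, ?_, ?_⟩
  · obtain ⟨p, hp, he⟩ := hRT s(x, y) hxy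
    exact (mem_edgeSet G).1 (he ▸ (mem_edgeSet G).2 (hTG p hp))
  · intro e he e' he' hee'
    obtain ⟨p, hp, rfl⟩ := hRT e he
    obtain ⟨p', hp', rfl⟩ := hRT e' he'
    obtain ⟨i, hi, rfl⟩ := List.mem_iff_getElem.1 hp
    obtain ⟨i', hi', rfl⟩ := List.mem_iff_getElem.1 hp'
    rw [(hcolor i hi).2, (hcolor i' hi').2] at hee'
    subst hee'
    rfl
  · have hreach : ∀ n, ∀ x ∈ (spread T)^[n] [a], R.Reachable (f a) (f x) := by
      intro n
      induction n with
      | zero => simp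
      | succ n ih =>
        rw [Function.iterate_succ_apply']
        exact reachable_of_mem_spread hTR ih
    have hroot : ∀ x ∈ S, R.Reachable (f a) x := by
      intro x hx
      have hgx : g x ∈ S.image g := Finset.mem_image_of_mem g hx
      rw [hSeq, Finset.mem_insert, Finset.mem_insert, Finset.mem_singleton] at hgx
      rw [← hfg x]
      rcases hgx with h | h | h <;> rw [h]
      exacts [hreach _ _ hb', hreach _ _ hd']
    exact fun x hx y hy => (hroot x hx).symm.trans (hroot y hy)

theorem Pattern.Valid.savesThree {P : Pattern} (hP : P.Valid) {V : Type*} [Finite V]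
    {G : SimpleGraph V} (hG : G.Connected) (h : Embeds G P.size P.edges) : SavesThree G :=
  SavesThree.of_embeds (hP.1 ▸ Nat.le_add_left 3 _) hP.savesThree_of_card hG h

/-- Colored graphs that save three colors. -/
def patterns : List Pattern := [
  ⟨6, [[(0, 1), (2, 3)], [(0, 4), (1, 2), (3, 5)], [(0, 5), (3, 4)]]⟩,
  ⟨6, [[(0, 1), (2, 3), (4, 5)], [(0, 5), (1, 2)], [(0, 3), (1, 4)]]⟩,
  ⟨6, [[(0, 1), (0, 2), (3, 4)], [(0, 4), (1, 2), (1, 3), (2, 3)], [(0, 5), (1, 4)]]⟩,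
  ⟨6, [[(0, 1), (0, 3), (2, 4), (2, 5)], [(0, 4), (1, 2)], [(0, 5), (2, 3)]]⟩,
  ⟨6, [[(0, 1), (0, 2), (3, 4), (3, 5)], [(0, 4), (1, 3)], [(1, 2), (4, 5)]]⟩,
  ⟨7, [[(0, 2), (0, 3), (4, 5)], [(0, 1), (2, 3)], [(0, 6), (1, 2)], [(1, 4), (1, 5)]]⟩,
  ⟨7, [[(0, 1), (0, 3)], [(0, 2), (0, 4)], [(0, 5), (3, 4)], [(0, 6), (1, 2)]]⟩,
  ⟨7, [[(0, 1), (2, 3)], [(0, 3), (1, 2)], [(0, 4), (5, 6)], [(0, 6), (4, 5)]]⟩,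
  ⟨8, [[(0, 1)], [(0, 5), (3, 4)], [(1, 2), (4, 5), (6, 7)], [(0, 2), (0, 3)], [(1, 6), (1, 7)]]⟩,
  ⟨8, [[(0, 1), (6, 7)], [(0, 3), (4, 5)], [(0, 2), (4, 7)], [(1, 2), (4, 6)], [(0, 5), (3, 4)]]⟩,
  ⟨9, [[(0, 2), (3, 4), (5, 6)], [(1, 2), (1, 7)], [(0, 3)], [(0, 4), (1, 8)], [(0, 1)],
    [(3, 5), (3, 6)]]⟩,
  ⟨9, [[(2, 8), (3, 4)], [(2, 7), (5, 6)], [(0, 2)], [(0, 6), (1, 4)], [(0, 1)], [(0, 5), (1, 3)]]⟩,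
  ⟨6, [[(0, 1), (0, 4), (2, 3)], [(0, 2), (0, 3), (1, 4)], [(0, 5), (1, 2)]]⟩,
  ⟨6, [[(0, 1), (0, 4), (2, 3)], [(0, 2), (0, 5), (1, 3)], [(0, 3), (1, 2), (4, 5)]]⟩]

theorem patterns_valid : ∀ P ∈ patterns, P.Valid := by decide +kernel

/-- The list `g` injects the graph with edge list `L'` on `0, …, k' - 1` into the graph with edge
list `L` on `0, …, k - 1`. -/
def IsCopy (g : List ℕ) (k' : ℕ) (L' : List (ℕ × ℕ)) (k : ℕ) (L : List (ℕ × ℕ)) : Prop :=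
  g.length = k' ∧ g.Nodup ∧ (∀ i ∈ g, i < k) ∧
    ∀ p ∈ L', p.1 < k' ∧ p.2 < k' ∧ hasEdge L (g.getD p.1 0) (g.getD p.2 0) = true

instance (g : List ℕ) (k' : ℕ) (L' : List (ℕ × ℕ)) (k : ℕ) (L : List (ℕ × ℕ)) :
    Decidable (IsCopy g k' L' k L) :=
  inferInstanceAs (Decidable (_ ∧ _ ∧ _ ∧ _))

theorem Embeds.of_isCopy {V : Type*} {G : SimpleGraph V} {g : List ℕ} {k k' : ℕ}
    {L L' : List (ℕ × ℕ)} (h : Embeds G k L) (hg : IsCopy g k' L' k L) : Embeds G k' L' := by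
  obtain ⟨f, hf, hL⟩ := h
  obtain ⟨rfl, hnodup, hlt, hedge⟩ := hg
  refine ⟨fun i => f (g.getD i 0), fun i hi j hj hij => ?_, fun p hp => ?_⟩
  · rw [Set.mem_Iio] at hi hj
    dsimp only at hij
    rw [List.getD_eq_getElem _ _ hi, List.getD_eq_getElem _ _ hj] at hij
    exact (hnodup.getElem_inj_iff).1
      (hf (hlt _ (List.getElem_mem hi)) (hlt _ (List.getElem_mem hj)) hij)
  · obtain ⟨h1, h2, h3⟩ := hedge p hp
    refine ⟨h1, h2, ?_⟩
    obtain h | h := hasEdge_iff.1 h3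
    exacts [(hL _ h).2.2, (hL _ h).2.2.symm]

/-- A graph on `0, …, size - 1` together with, for each of its extensions, the index of a graph
already dealt with and a copy of that graph in the extension. -/
structure Stage where
  size : ℕ
  edges : List (ℕ × ℕ)
  copies : List (ℕ × List ℕ)

/-- Every extension of the stage `s` contains one of the graphs in `known`, as certified by
`s.copies`. -/
def Stage.Covered (known : List (ℕ × List (ℕ × ℕ))) (exts : List (ℕ × List (ℕ × ℕ)))
    (s : Stage) : Prop :=
  List.Forall₂ (fun e c => ∃ t ∈ known[c.1]?, IsCopy c.2 t.1 t.2 e.1 e.2) exts s.copies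

instance (known exts : List (ℕ × List (ℕ × ℕ))) (s : Stage) : Decidable (s.Covered known exts) :=
  inferInstanceAs (Decidable (List.Forall₂ _ _ _))

/-- Every stage is covered by `known` and the stages that precede it. -/
def AllCovered (ext : ℕ → List (ℕ × ℕ) → List (ℕ × List (ℕ × ℕ))) :
    List (ℕ × List (ℕ × ℕ)) → List Stage → Prop
  | _, [] => True
  | known, s :: rest =>
    s.Covered known (ext s.size s.edges) ∧ AllCovered ext (known ++ [(s.size, s.edges)]) rest

instance decidableAllCovered (ext : ℕ → List (ℕ × ℕ) → List (ℕ × List (ℕ × ℕ))) :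
    ∀ known stages, Decidable (AllCovered ext known stages)
  | _, [] => isTrue trivial
  | known, s :: rest =>
    have := decidableAllCovered ext (known ++ [(s.size, s.edges)]) rest
    inferInstanceAs (Decidable (s.Covered _ _ ∧ AllCovered _ _ _))

theorem AllCovered.savesThree {ext : ℕ → List (ℕ × ℕ) → List (ℕ × List (ℕ × ℕ))}
    {known : List (ℕ × List (ℕ × ℕ))} {stages : List Stage} (h : AllCovered ext known stages)
    {V : Type*} {G : SimpleGraph V} (hknown : ∀ t ∈ known, Embeds G t.1 t.2 → SavesThree G)
    (hext : ∀ s ∈ stages, Embeds G s.size s.edges →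
      ∃ e ∈ ext s.size s.edges, Embeds G e.1 e.2) :
    ∀ s ∈ stages, Embeds G s.size s.edges → SavesThree G := by
  induction stages generalizing known with
  | nil => simp
  | cons s rest ih =>
    obtain ⟨hs, hrest⟩ := h
    have hsave : Embeds G s.size s.edges → SavesThree G := by
      intro hemb
      obtain ⟨e, he, heG⟩ := hext s List.mem_cons_self hemb
      obtain ⟨i, hi, rfl⟩ := List.mem_iff_getElem.1 he
      rw [Stage.Covered, List.forall₂_iff_get] at hs
      obtain ⟨t, ht, hcopy⟩ := hs.2 i hi (hs.1 ▸ hi)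
      exact hknown t (List.mem_of_getElem? ht) (heG.of_isCopy hcopy)
    refine List.forall_mem_cons.2 ⟨hsave, ih hrest ?_ fun s' hs' =>
      hext s' (List.mem_cons_of_mem _ hs')⟩
    intro t ht
    obtain ht | ht := List.mem_append.1 ht
    · exact hknown t ht
    · rw [List.mem_singleton.1 ht]
      exact hsave

/-- The sizes and edge lists of the patterns. -/
def patternGraphs : List (ℕ × List (ℕ × ℕ)) := patterns.map fun P => (P.size, P.edges)

theorem savesThree_of_mem_patternGraphs {V : Type*} [Finite V] {G : SimpleGraph V}
    (hG : G.Connected) : ∀ t ∈ patternGraphs, Embeds G t.1 t.2 → SavesThree G := by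
  intro t ht h
  obtain ⟨P, hP, rfl⟩ := List.mem_map.1 ht
  exact (patterns_valid P hP).savesThree hG h

/-- All ways to add one edge. -/
def edgeExts (k : ℕ) (L : List (ℕ × ℕ)) : List (ℕ × List (ℕ × ℕ)) :=
  (List.range k).flatMap fun j =>
    ((List.range j).filter fun i => !hasEdge L i j).map fun i => (k, (i, j) :: L)

/-- All ways to add one vertex with one edge. -/
def pendantExts (k : ℕ) (L : List (ℕ × ℕ)) : List (ℕ × List (ℕ × ℕ)) :=
  (List.range k).map fun i => (k + 1, (i, k) :: L)

/-- All ways to attach a triangle along two vertices or along one vertex. -/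
def triangleExts (k : ℕ) (L : List (ℕ × ℕ)) : List (ℕ × List (ℕ × ℕ)) :=
  ((List.range k).flatMap fun j => (List.range j).map fun i =>
    (k + 1, (i, k) :: (j, k) :: if hasEdge L i j then L else (i, j) :: L)) ++
  (List.range k).map fun i => (k + 2, (i, k) :: (i, k + 1) :: (k, k + 1) :: L)

theorem Embeds.exists_edgeExts {V : Type*} [Finite V] {G : SimpleGraph V} {k : ℕ}
    {L : List (ℕ × ℕ)} (h : Embeds G k L) (hcard : Nat.card V = k)
    (hL : L.length < G.edgeSet.ncard) : ∃ e ∈ edgeExts k L, Embeds G e.1 e.2 := by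
  classical
  obtain ⟨f, hf, hfL⟩ := h
  obtain ⟨e, he, heL⟩ : ∃ e ∈ G.edgeSet, e ∉ (L.map fun p : ℕ × ℕ => s(f p.1, f p.2)).toFinset := by
    by_contra! hsub
    have h1 := Set.ncard_le_ncard (s := G.edgeSet)
      (t := ((L.map fun p : ℕ × ℕ => s(f p.1, f p.2)).toFinset : Set (Sym2 V))) hsub
      (Finset.finite_toSet _)
    rw [Set.ncard_coe_finset] at h1
    have h2 := List.toFinset_card_le (L.map fun p : ℕ × ℕ => s(f p.1, f p.2))
    rw [List.length_map] at h2
    omega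
  have himage : f '' Set.Iio k = Set.univ := by
    refine Set.eq_of_subset_of_ncard_le (Set.subset_univ _) ?_ (Set.toFinite _)
    rw [hf.ncard_image, Set.ncard_Iio_nat, Set.ncard_univ, hcard]
  induction e with | _ x y
  obtain ⟨i, hi, rfl⟩ := himage.symm ▸ Set.mem_univ x
  obtain ⟨j, hj, rfl⟩ := himage.symm ▸ Set.mem_univ y
  rw [Set.mem_Iio] at hi hj
  rw [mem_edgeSet] at he
  wlog hij : i < j generalizing i j
  · have hne : i ≠ j := fun h => he.ne (h ▸ rfl)
    exact this j hj i hi he.symm (by rwa [Sym2.eq_swap]) (by omega)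
  refine ⟨(k, (i, j) :: L), ?_, f, hf, List.forall_mem_cons.2 ⟨⟨hi, hj, he⟩, hfL⟩⟩
  refine List.mem_flatMap.2 ⟨j, List.mem_range.2 hj, List.mem_map.2 ⟨i, ?_, rfl⟩⟩
  rw [List.mem_filter, List.mem_range, Bool.not_eq_true', Bool.eq_false_iff]
  refine ⟨hij, fun hedge => heL ?_⟩
  rw [List.mem_toFinset, List.mem_map]
  obtain h | h := hasEdge_iff.1 hedge
  exacts [⟨_, h, rfl⟩, ⟨_, h, Sym2.eq_swap⟩]

theorem injOn_update_succ {V : Type*} {f : ℕ → V} {k : ℕ} (hf : Set.InjOn f (Set.Iio k)) {y : V}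
    (hy : ∀ j < k, f j ≠ y) : Set.InjOn (Function.update f k y) (Set.Iio (k + 1)) := by
  intro i hi j hj hij
  rw [Set.mem_Iio] at hi hj
  by_cases hik : i = k <;> by_cases hjk : j = k
  · rw [hik, hjk]
  · rw [hik, Function.update_self, Function.update_of_ne hjk] at hij
    exact absurd hij.symm (hy j (by omega))
  · rw [hjk, Function.update_self, Function.update_of_ne hik] at hij
    exact absurd hij (hy i (by omega))
  · rw [Function.update_of_ne hik, Function.update_of_ne hjk] at hij
    exact hf (show i < k by omega) (show j < k by omega) hij

theorem Embeds.exists_pendantExts {V : Type*} [Finite V] {G : SimpleGraph V} (hG : G.Connected)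
    {k : ℕ} {L : List (ℕ × ℕ)} (h : Embeds G k L) (hk : 0 < k) (hcard : k < Nat.card V) :
    ∃ e ∈ pendantExts k L, Embeds G e.1 e.2 := by
  obtain ⟨f, hf, hfL⟩ := h
  obtain ⟨i, hi, y, hy, hadj⟩ := exists_adj_notMem_image hG f hk hcard
  have hupd : ∀ j < k, Function.update f k y j = f j := fun j hj =>
    Function.update_of_ne hj.ne _ _
  refine ⟨(k + 1, (i, k) :: L), List.mem_map.2 ⟨i, List.mem_range.2 hi, rfl⟩,
    Function.update f k y, injOn_update_succ hf hy,
    List.forall_mem_cons.2 ⟨⟨by dsimp; omega, by simp, ?_⟩, ?_⟩⟩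
  · simpa [hupd i hi] using hadj
  · intro p hp
    obtain ⟨h1, h2, h3⟩ := hfL p hp
    rw [hupd _ h1, hupd _ h2]
    exact ⟨by dsimp; omega, by dsimp; omega, h3⟩

theorem Embeds.exists_triangleExts {V : Type*} [Finite V] {G : SimpleGraph V} (hG : G.Connected)
    (htri : ∀ x y, G.Adj x y → ∃ z, G.Adj x z ∧ G.Adj y z)
    {k : ℕ} {L : List (ℕ × ℕ)} (h : Embeds G k L) (hk : 0 < k) (hcard : k < Nat.card V) :
    ∃ e ∈ triangleExts k L, Embeds G e.1 e.2 := by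
  obtain ⟨f, hf, hfL⟩ := h
  obtain ⟨i, hi, y, hy, hadj⟩ := exists_adj_notMem_image hG f hk hcard
  obtain ⟨z, hiz, hyz⟩ := htri _ _ hadj
  have hupd : ∀ j < k, Function.update f k y j = f j := fun j hj =>
    Function.update_of_ne hj.ne _ _
  by_cases hz : ∃ j < k, f j = z
  · obtain ⟨j, hj, rfl⟩ := hz
    wlog hij : i < j generalizing i j
    · have hne : i ≠ j := fun h => hiz.ne (h ▸ rfl)
      exact this j hj hyz.symm i hi hiz.symm hadj.symm (by omega)
    refine ⟨(k + 1, (i, k) :: (j, k) :: if hasEdge L i j then L else (i, j) :: L),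
      List.mem_append_left _ (List.mem_flatMap.2 ⟨j, List.mem_range.2 hj, List.mem_map.2
        ⟨i, List.mem_range.2 hij, rfl⟩⟩), Function.update f k y, injOn_update_succ hf hy, ?_⟩
    have hsub : ∀ p ∈ (i, k) :: (j, k) :: (if hasEdge L i j then L else (i, j) :: L),
        p = (i, k) ∨ p = (j, k) ∨ p = (i, j) ∨ p ∈ L := by
      intro p hp
      split_ifs at hp <;> simp only [List.mem_cons] at hp <;> tauto
    intro p hp
    obtain rfl | rfl | rfl | hp := hsub p hp
    · exact ⟨by dsimp; omega, by simp, by simpa [hupd i hi] using hadj⟩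
    · exact ⟨by dsimp; omega, by simp, by simpa [hupd j hj] using hyz.symm⟩
    · exact ⟨by dsimp; omega, by dsimp; omega, by simpa [hupd j hj, hupd i hi] using hiz⟩
    · obtain ⟨h1, h2, h3⟩ := hfL p hp
      rw [hupd _ h1, hupd _ h2]
      exact ⟨by dsimp; omega, by dsimp; omega, h3⟩
  · push Not at hz
    have hinj := injOn_update_succ hf hy
    have hz' : ∀ j < k + 1, Function.update f k y j ≠ z := by
      intro j hj
      by_cases hjk : j = k
      · rw [hjk, Function.update_self]
        exact hyz.ne
      · rw [Function.update_of_ne hjk]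
        exact hz j (by omega)
    have hupd' : ∀ j < k, Function.update (Function.update f k y) (k + 1) z j = f j :=
      fun j hj => by rw [Function.update_of_ne (by omega), hupd j hj]
    have hupdk : Function.update (Function.update f k y) (k + 1) z k = y := by
      rw [Function.update_of_ne (by omega), Function.update_self]
    refine ⟨(k + 2, (i, k) :: (i, k + 1) :: (k, k + 1) :: L),
      List.mem_append_right _ (List.mem_map.2 ⟨i, List.mem_range.2 hi, rfl⟩),
      Function.update (Function.update f k y) (k + 1) z, injOn_update_succ hinj hz', ?_⟩
    simp only [List.forall_mem_cons, Function.update_self, hupdk, hupd' i hi]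
    refine ⟨⟨by omega, by omega, hadj⟩, ⟨by omega, by omega, hiz⟩, ⟨by omega, by omega, hyz⟩,
      fun p hp => ?_⟩
    obtain ⟨h1, h2, h3⟩ := hfL p hp
    rw [hupd' _ h1, hupd' _ h2]
    exact ⟨by omega, by omega, h3⟩

/-- Extensions towards a six-vertex graph: first span all vertices, then add edges. -/
def sixExts (k : ℕ) (L : List (ℕ × ℕ)) : List (ℕ × List (ℕ × ℕ)) :=
  if k = 6 then edgeExts k L else pendantExts k L

/-- Extensions in a graph all of whose edges lie in triangles; for a seven-vertex stage the host
graph may have no further vertices. -/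
def growExts (k : ℕ) (L : List (ℕ × ℕ)) : List (ℕ × List (ℕ × ℕ)) :=
  (if k = 7 then edgeExts k L else []) ++ triangleExts k L

/-- Graphs grown from a star with four leaves towards ten edges on six vertices. -/
def sixStages : List Stage := [
  ⟨6, [(0, 1), (0, 2), (0, 3), (0, 4), (1, 2), (1, 3), (1, 5), (2, 3), (2, 4)],
    [(2, [1, 0, 3, 2, 4, 5]), (2, [1, 0, 2, 4, 3, 5]), (0, [0, 4, 2, 1, 3, 5]),
     (0, [0, 1, 5, 2, 3, 4]), (1, [0, 1, 2, 4, 5, 3]), (0, [0, 4, 5, 1, 2, 3])]⟩,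
  ⟨6, [(0, 1), (0, 2), (0, 3), (0, 4), (1, 2), (1, 3), (1, 5), (2, 4), (2, 5)],
    [(0, [0, 1, 5, 2, 3, 4]), (0, [0, 2, 5, 1, 3, 4]), (0, [1, 3, 4, 2, 0, 5]),
     (0, [0, 3, 1, 2, 4, 5]), (0, [0, 3, 5, 2, 1, 4]), (0, [0, 3, 1, 5, 2, 4])]⟩,
  ⟨6, [(0, 1), (0, 2), (0, 3), (0, 4), (1, 2), (1, 3), (1, 4), (2, 5), (3, 4)],
    [(2, [2, 0, 1, 4, 3, 5]), (2, [2, 0, 1, 3, 4, 5]), (0, [0, 5, 2, 1, 3, 4]),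
     (0, [0, 2, 5, 1, 3, 4]), (0, [0, 2, 5, 3, 1, 4]), (0, [0, 2, 5, 4, 1, 3])]⟩,
  ⟨6, [(0, 1), (0, 2), (0, 3), (0, 4), (0, 5), (1, 2), (1, 3), (2, 3)],
    [(12, [0, 1, 2, 3, 4, 5]), (12, [0, 1, 2, 4, 3, 5]), (12, [0, 1, 3, 4, 2, 5]),
     (12, [0, 1, 2, 3, 5, 4]), (12, [0, 1, 2, 5, 3, 4]), (12, [0, 1, 3, 5, 2, 4]),
     (13, [0, 1, 2, 3, 4, 5])]⟩,
  ⟨6, [(0, 1), (0, 2), (0, 3), (0, 4), (0, 5), (1, 2), (1, 3), (1, 4)],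
    [(12, [0, 1, 2, 3, 4, 5]), (12, [0, 1, 2, 4, 3, 5]), (12, [0, 1, 3, 4, 2, 5]),
     (3, [0, 2, 1, 3, 4, 5]), (0, [0, 5, 2, 1, 3, 4]), (0, [0, 5, 3, 1, 2, 4]),
     (0, [0, 5, 4, 1, 2, 3])]⟩,
  ⟨6, [(0, 1), (0, 2), (0, 3), (0, 4), (0, 5), (1, 2), (1, 3), (4, 5)],
    [(13, [0, 1, 2, 3, 4, 5]), (0, [0, 5, 4, 1, 2, 3]), (1, [0, 2, 1, 3, 4, 5]),
     (1, [0, 3, 1, 2, 4, 5]), (0, [0, 4, 5, 1, 2, 3]), (1, [0, 2, 1, 3, 5, 4]),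
     (1, [0, 3, 1, 2, 5, 4])]⟩,
  ⟨6, [(0, 1), (0, 2), (0, 3), (0, 4), (1, 2), (1, 3), (1, 5), (2, 3)],
    [(12, [1, 0, 2, 3, 4, 5]), (14, [0, 1, 2, 3, 4, 5]), (14, [0, 1, 3, 2, 4, 5]),
     (12, [0, 1, 2, 3, 5, 4]), (14, [1, 0, 2, 3, 5, 4]), (14, [1, 0, 3, 2, 5, 4]),
     (0, [0, 4, 5, 1, 2, 3])]⟩,
  ⟨6, [(0, 1), (0, 2), (0, 3), (0, 4), (1, 2), (1, 3), (1, 5), (2, 4)],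
    [(14, [0, 1, 2, 3, 4, 5]), (12, [1, 0, 2, 4, 3, 5]), (2, [1, 0, 2, 4, 3, 5]),
     (0, [0, 4, 2, 1, 3, 5]), (15, [0, 1, 2, 3, 4, 5]), (1, [0, 1, 2, 4, 5, 3]),
     (0, [0, 4, 5, 1, 2, 3])]⟩,
  ⟨6, [(0, 1), (0, 2), (0, 3), (0, 4), (1, 2), (1, 3), (1, 4), (2, 5)],
    [(14, [0, 2, 1, 3, 4, 5]), (14, [0, 2, 1, 4, 3, 5]), (16, [0, 1, 2, 3, 4, 5]),
     (0, [0, 5, 2, 1, 3, 4]), (0, [0, 2, 5, 1, 3, 4]), (1, [0, 2, 1, 4, 5, 3]),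
     (1, [0, 2, 1, 3, 5, 4])]⟩,
  ⟨6, [(0, 1), (0, 2), (0, 3), (0, 4), (1, 2), (1, 5), (2, 3), (3, 4)],
    [(14, [0, 1, 3, 2, 4, 5]), (2, [1, 0, 2, 3, 4, 5]), (16, [0, 2, 1, 3, 4, 5]),
     (1, [0, 2, 1, 5, 3, 4]), (1, [0, 2, 3, 4, 5, 1]), (0, [0, 1, 5, 3, 2, 4]),
     (0, [1, 2, 3, 4, 0, 5])]⟩,
  ⟨6, [(0, 1), (0, 2), (0, 3), (0, 5), (1, 2), (1, 4), (2, 3), (3, 4)],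
    [(14, [1, 0, 3, 2, 4, 5]), (12, [0, 1, 2, 3, 4, 5]), (2, [0, 2, 1, 4, 3, 5]),
     (0, [0, 3, 4, 1, 2, 5]), (1, [0, 1, 2, 5, 4, 3]), (0, [0, 1, 4, 3, 2, 5]),
     (0, [0, 2, 1, 4, 3, 5])]⟩,
  ⟨6, [(0, 1), (0, 2), (0, 4), (0, 5), (1, 2), (1, 3), (2, 3), (4, 5)],
    [(13, [0, 1, 2, 3, 4, 5]), (1, [0, 1, 3, 2, 4, 5]), (1, [0, 2, 3, 1, 4, 5]),
     (0, [0, 5, 4, 3, 1, 2]), (1, [0, 1, 3, 2, 5, 4]), (1, [0, 2, 3, 1, 5, 4]),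
     (0, [0, 4, 5, 3, 1, 2])]⟩,
  ⟨6, [(0, 1), (0, 2), (0, 3), (0, 4), (1, 2), (1, 5), (3, 4), (3, 5)],
    [(15, [0, 1, 3, 2, 4, 5]), (0, [0, 1, 5, 3, 2, 4]), (0, [0, 3, 5, 1, 2, 4]),
     (0, [1, 2, 4, 3, 0, 5]), (1, [0, 5, 1, 2, 3, 4]), (0, [0, 4, 3, 5, 1, 2]),
     (0, [0, 2, 1, 5, 3, 4])]⟩,
  ⟨6, [(0, 1), (0, 2), (0, 4), (0, 5), (1, 2), (1, 3), (2, 3), (3, 4)],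
    [(12, [0, 1, 3, 4, 2, 5]), (2, [0, 1, 2, 3, 4, 5]), (2, [0, 2, 1, 3, 4, 5]),
     (0, [0, 4, 3, 1, 2, 5]), (0, [0, 4, 3, 2, 1, 5]), (0, [0, 1, 2, 3, 4, 5]),
     (0, [0, 5, 4, 3, 1, 2])]⟩,
  ⟨6, [(0, 1), (0, 2), (0, 3), (0, 4), (1, 2), (1, 3), (2, 3), (4, 5)],
    [(16, [0, 1, 4, 2, 3, 5]), (16, [0, 2, 4, 1, 3, 5]), (16, [0, 3, 4, 1, 2, 5]),
     (13, [0, 1, 2, 3, 4, 5]), (0, [0, 4, 5, 1, 2, 3]), (0, [0, 4, 5, 2, 1, 3]),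
     (0, [0, 4, 5, 3, 1, 2])]⟩,
  ⟨6, [(0, 1), (0, 2), (0, 3), (0, 4), (0, 5), (1, 2), (1, 3)],
    [(17, [0, 1, 2, 3, 4, 5]), (18, [0, 1, 2, 3, 4, 5]), (12, [0, 1, 2, 4, 3, 5]),
     (12, [0, 1, 3, 4, 2, 5]), (18, [0, 1, 2, 3, 5, 4]), (12, [0, 1, 2, 5, 3, 4]),
     (12, [0, 1, 3, 5, 2, 4]), (19, [0, 1, 2, 3, 4, 5])]⟩,
  ⟨6, [(0, 1), (0, 2), (0, 3), (0, 4), (0, 5), (1, 2), (3, 4)],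
    [(12, [0, 1, 3, 4, 2, 5]), (12, [0, 2, 3, 4, 1, 5]), (12, [0, 1, 4, 3, 2, 5]),
     (12, [0, 2, 4, 3, 1, 5]), (19, [0, 1, 2, 5, 3, 4]), (19, [0, 2, 1, 5, 3, 4]),
     (19, [0, 3, 4, 5, 1, 2]), (19, [0, 4, 3, 5, 1, 2])]⟩,
  ⟨6, [(0, 1), (0, 2), (0, 3), (0, 4), (1, 2), (1, 3), (1, 5)],
    [(20, [0, 1, 2, 3, 4, 5]), (18, [1, 0, 2, 3, 4, 5]), (21, [0, 1, 2, 3, 4, 5]),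
     (21, [0, 1, 3, 2, 4, 5]), (18, [0, 1, 2, 3, 5, 4]), (21, [1, 0, 2, 3, 5, 4]),
     (21, [1, 0, 3, 2, 5, 4]), (0, [0, 4, 5, 1, 2, 3])]⟩,
  ⟨6, [(0, 1), (0, 2), (0, 3), (0, 4), (1, 2), (1, 5), (2, 3)],
    [(20, [0, 1, 2, 3, 4, 5]), (21, [0, 1, 2, 4, 3, 5]), (22, [0, 2, 1, 3, 4, 5]),
     (23, [0, 1, 2, 3, 4, 5]), (12, [0, 1, 2, 3, 5, 4]), (21, [2, 0, 1, 3, 5, 4]),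
     (24, [0, 1, 2, 3, 5, 4]), (1, [0, 1, 2, 3, 5, 4])]⟩,
  ⟨6, [(0, 1), (0, 2), (0, 3), (0, 4), (1, 2), (1, 5), (3, 4)],
    [(21, [0, 1, 3, 2, 4, 5]), (23, [0, 1, 2, 3, 4, 5]), (21, [0, 1, 4, 2, 3, 5]),
     (23, [0, 1, 2, 4, 3, 5]), (19, [0, 1, 2, 5, 3, 4]), (25, [0, 1, 2, 5, 3, 4]),
     (26, [0, 1, 2, 3, 4, 5]), (26, [0, 1, 2, 4, 3, 5])]⟩,
  ⟨6, [(0, 1), (0, 2), (0, 4), (0, 5), (1, 2), (1, 3), (2, 3)],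
    [(17, [0, 1, 2, 3, 4, 5]), (21, [1, 0, 2, 4, 3, 5]), (21, [2, 0, 1, 4, 3, 5]),
     (27, [0, 1, 2, 3, 4, 5]), (21, [1, 0, 2, 5, 3, 4]), (21, [2, 0, 1, 5, 3, 4]),
     (27, [0, 1, 2, 3, 5, 4]), (25, [0, 1, 2, 3, 4, 5])]⟩,
  ⟨6, [(0, 1), (0, 2), (0, 3), (0, 5), (1, 2), (1, 4), (3, 4)],
    [(21, [1, 0, 3, 2, 4, 5]), (24, [0, 1, 2, 3, 4, 5]), (12, [0, 1, 4, 3, 2, 5]),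
     (27, [0, 1, 2, 4, 3, 5]), (0, [0, 3, 4, 1, 2, 5]), (1, [0, 1, 2, 5, 4, 3]),
     (26, [0, 1, 2, 3, 5, 4]), (0, [0, 2, 1, 4, 3, 5])]⟩,
  ⟨6, [(0, 1), (0, 2), (0, 3), (0, 4), (1, 2), (1, 3), (4, 5)],
    [(28, [0, 1, 2, 3, 4, 5]), (22, [0, 1, 4, 2, 3, 5]), (23, [0, 4, 2, 1, 3, 5]),
     (23, [0, 4, 3, 1, 2, 5]), (19, [0, 1, 2, 3, 4, 5]), (0, [0, 4, 5, 1, 2, 3]),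
     (1, [0, 2, 1, 3, 5, 4]), (1, [0, 3, 1, 2, 5, 4])]⟩,
  ⟨6, [(0, 1), (0, 2), (0, 3), (0, 4), (1, 5), (2, 3), (4, 5)],
    [(1, [0, 1, 2, 3, 5, 4]), (1, [0, 1, 3, 2, 5, 4]), (25, [0, 1, 4, 5, 2, 3]),
     (1, [0, 4, 2, 3, 5, 1]), (1, [0, 4, 3, 2, 5, 1]), (19, [0, 5, 1, 4, 2, 3]),
     (0, [0, 3, 2, 5, 1, 4]), (0, [0, 2, 3, 5, 1, 4])]⟩,
  ⟨6, [(0, 1), (0, 3), (0, 4), (0, 5), (1, 2), (2, 3), (2, 4)],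
    [(18, [0, 2, 1, 3, 4, 5]), (27, [0, 1, 3, 2, 4, 5]), (27, [0, 1, 4, 2, 3, 5]),
     (27, [0, 3, 4, 2, 1, 5]), (0, [0, 5, 1, 2, 3, 4]), (3, [0, 1, 2, 3, 4, 5]),
     (0, [0, 5, 3, 2, 1, 4]), (0, [0, 5, 4, 2, 1, 3])]⟩,
  ⟨6, [(0, 1), (0, 2), (0, 3), (0, 4), (0, 5), (1, 2)],
    [(29, [0, 1, 2, 3, 4, 5]), (29, [0, 2, 1, 3, 4, 5]), (29, [0, 1, 2, 4, 3, 5]),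
     (29, [0, 2, 1, 4, 3, 5]), (30, [0, 1, 2, 3, 4, 5]), (29, [0, 1, 2, 5, 3, 4]),
     (29, [0, 2, 1, 5, 3, 4]), (30, [0, 1, 2, 3, 5, 4]), (30, [0, 1, 2, 4, 5, 3])]⟩,
  ⟨6, [(0, 1), (0, 2), (0, 3), (0, 4), (1, 2), (1, 5)],
    [(31, [0, 1, 2, 3, 4, 5]), (32, [0, 1, 2, 3, 4, 5]), (31, [0, 1, 2, 4, 3, 5]),
     (32, [0, 1, 2, 4, 3, 5]), (33, [0, 1, 2, 3, 4, 5]), (29, [0, 1, 2, 5, 3, 4]),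
     (34, [0, 1, 2, 5, 3, 4]), (35, [0, 1, 2, 3, 5, 4]), (35, [0, 1, 2, 4, 5, 3])]⟩,
  ⟨6, [(0, 1), (0, 2), (0, 3), (0, 4), (1, 5), (2, 3)],
    [(32, [0, 1, 2, 3, 4, 5]), (32, [0, 1, 3, 2, 4, 5]), (33, [0, 1, 4, 2, 3, 5]),
     (36, [0, 2, 3, 4, 1, 5]), (36, [0, 3, 2, 4, 1, 5]), (30, [0, 1, 5, 2, 3, 4]),
     (35, [0, 2, 3, 1, 5, 4]), (35, [0, 3, 2, 1, 5, 4]), (37, [0, 1, 2, 3, 4, 5])]⟩,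
  ⟨6, [(0, 1), (0, 2), (0, 4), (0, 5), (1, 3), (2, 3)],
    [(34, [0, 1, 2, 3, 4, 5]), (29, [0, 3, 1, 2, 4, 5]), (35, [0, 1, 4, 2, 3, 5]),
     (35, [0, 2, 4, 1, 3, 5]), (38, [0, 1, 3, 2, 4, 5]), (35, [0, 1, 5, 2, 3, 4]),
     (35, [0, 2, 5, 1, 3, 4]), (38, [0, 1, 3, 2, 5, 4]), (37, [0, 1, 4, 5, 2, 3])]⟩,
  ⟨6, [(0, 1), (0, 2), (0, 3), (0, 4), (0, 5)],
    [(39, [0, 1, 2, 3, 4, 5]), (39, [0, 1, 3, 2, 4, 5]), (39, [0, 2, 3, 1, 4, 5]),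
     (39, [0, 1, 4, 2, 3, 5]), (39, [0, 2, 4, 1, 3, 5]), (39, [0, 3, 4, 1, 2, 5]),
     (39, [0, 1, 5, 2, 3, 4]), (39, [0, 2, 5, 1, 3, 4]), (39, [0, 3, 5, 1, 2, 4]),
     (39, [0, 4, 5, 1, 2, 3])]⟩,
  ⟨6, [(0, 1), (0, 2), (0, 3), (0, 4), (1, 5)],
    [(40, [0, 1, 2, 3, 4, 5]), (40, [0, 1, 3, 2, 4, 5]), (41, [0, 1, 2, 3, 4, 5]),
     (40, [0, 1, 4, 2, 3, 5]), (41, [0, 1, 2, 4, 3, 5]), (41, [0, 1, 3, 4, 2, 5]),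
     (39, [0, 1, 5, 2, 3, 4]), (42, [0, 1, 2, 5, 3, 4]), (42, [0, 1, 3, 5, 2, 4]),
     (42, [0, 1, 4, 5, 2, 3])]⟩,
  ⟨5, [(0, 1), (0, 2), (0, 3), (0, 4)],
    [(43, [0, 1, 2, 3, 4, 5]), (44, [0, 1, 2, 3, 4, 5]), (44, [0, 2, 1, 3, 4, 5]),
     (44, [0, 3, 1, 2, 4, 5]), (44, [0, 4, 1, 2, 3, 5])]⟩]

/-- Graphs grown from a triangle by attaching triangles. -/
def triangleStages : List Stage := [
  ⟨7, [(0, 1), (0, 2), (0, 3), (0, 4), (1, 2), (1, 5), (1, 6), (3, 4), (5, 6)],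
    [(5, [0, 1, 3, 4, 5, 6, 2]), (5, [0, 1, 2, 3, 5, 6, 4]), (5, [0, 1, 4, 3, 5, 6, 2]),
     (5, [0, 1, 2, 4, 5, 6, 3]), (5, [1, 0, 5, 6, 3, 4, 2]), (5, [1, 0, 2, 5, 3, 4, 6]),
     (4, [0, 3, 4, 5, 1, 6]), (4, [0, 4, 3, 5, 1, 6]), (5, [1, 0, 6, 5, 3, 4, 2]),
     (5, [1, 0, 2, 6, 3, 4, 5]), (4, [0, 3, 4, 6, 1, 5]), (4, [0, 4, 3, 6, 1, 5]),
     (9, [0, 3, 4, 2, 1, 7, 5, 6]), (5, [0, 1, 2, 7, 5, 6, 3]), (5, [1, 0, 2, 7, 3, 4, 5]),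
     (8, [0, 1, 2, 4, 3, 7, 5, 6]), (5, [0, 1, 3, 4, 5, 6, 2]), (5, [0, 1, 2, 3, 5, 6, 4]),
     (8, [0, 1, 2, 3, 4, 7, 5, 6]), (5, [0, 1, 4, 3, 5, 6, 2]), (5, [0, 1, 2, 4, 5, 6, 3]),
     (8, [0, 1, 2, 3, 7, 4, 5, 6]), (5, [1, 0, 5, 6, 3, 4, 2]), (8, [1, 0, 2, 6, 5, 7, 3, 4]),
     (5, [1, 0, 2, 5, 3, 4, 6]), (4, [0, 1, 2, 5, 3, 7]), (4, [0, 1, 2, 5, 4, 7]),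
     (5, [1, 0, 6, 5, 3, 4, 2]), (8, [1, 0, 2, 5, 6, 7, 3, 4]), (5, [1, 0, 2, 6, 3, 4, 5]),
     (4, [0, 1, 2, 6, 3, 7]), (4, [0, 1, 2, 6, 4, 7]), (8, [1, 0, 2, 5, 7, 6, 3, 4]),
     (6, [0, 1, 2, 3, 4, 7, 8]), (6, [1, 0, 2, 5, 6, 7, 8]), (11, [0, 1, 2, 5, 6, 3, 4, 7, 8]),
     (10, [0, 1, 2, 3, 4, 7, 8, 5, 6]), (10, [0, 1, 2, 4, 3, 7, 8, 5, 6]),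
     (10, [1, 0, 2, 5, 6, 7, 8, 3, 4]), (10, [1, 0, 2, 6, 5, 7, 8, 3, 4])]⟩,
  ⟨6, [(0, 1), (0, 2), (0, 3), (0, 4), (1, 2), (1, 3), (1, 5), (2, 4), (2, 5)],
    [(0, [0, 2, 5, 1, 3, 6]), (0, [0, 1, 5, 2, 4, 6]), (0, [1, 0, 4, 2, 5, 6]),
     (1, [0, 1, 2, 4, 3, 6]), (1, [0, 1, 2, 4, 6, 3]), (0, [0, 1, 5, 2, 3, 4]),
     (1, [0, 2, 1, 3, 4, 6]), (0, [0, 2, 5, 1, 3, 4]), (1, [0, 2, 1, 3, 6, 4]),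
     (0, [1, 3, 4, 2, 0, 5]), (0, [0, 3, 1, 2, 4, 5]), (1, [1, 2, 0, 3, 5, 6]),
     (1, [1, 2, 0, 3, 6, 5]), (0, [0, 3, 5, 2, 1, 4]), (0, [0, 3, 1, 5, 2, 4]),
     (5, [1, 0, 2, 5, 6, 7, 3]), (5, [0, 1, 2, 4, 6, 7, 3]), (5, [0, 2, 1, 3, 6, 7, 4]),
     (5, [0, 3, 1, 2, 6, 7, 4]), (5, [0, 4, 2, 1, 6, 7, 3]), (5, [1, 5, 2, 0, 6, 7, 3])]⟩,
  ⟨6, [(0, 1), (0, 2), (0, 3), (0, 4), (0, 5), (1, 2), (1, 3), (4, 5)],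
    [(6, [0, 1, 2, 4, 5, 3, 6]), (6, [0, 1, 2, 4, 5, 3, 6]), (5, [1, 0, 2, 6, 4, 5, 3]),
     (6, [0, 1, 2, 3, 6, 4, 5]), (5, [1, 0, 3, 6, 4, 5, 2]), (5, [2, 0, 1, 3, 4, 5, 6]),
     (6, [0, 1, 2, 4, 5, 3, 6]), (0, [0, 4, 6, 1, 2, 3]), (1, [0, 2, 1, 3, 4, 5]),
     (1, [0, 3, 1, 2, 4, 5]), (6, [0, 1, 2, 4, 5, 3, 6]), (0, [0, 4, 5, 1, 2, 3]),
     (1, [0, 2, 1, 3, 5, 4]), (1, [0, 3, 1, 2, 5, 4]), (7, [0, 2, 1, 3, 4, 6, 5]),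
     (6, [0, 1, 2, 4, 5, 3, 6]), (9, [0, 4, 5, 2, 1, 3, 6, 7]), (5, [0, 2, 1, 3, 6, 7, 4]),
     (5, [0, 3, 1, 2, 6, 7, 4]), (8, [0, 4, 5, 2, 1, 3, 6, 7]), (8, [0, 5, 4, 2, 1, 3, 6, 7])]⟩,
  ⟨6, [(0, 1), (0, 2), (0, 4), (0, 5), (1, 2), (1, 3), (2, 3), (4, 5)],
    [(5, [1, 0, 2, 3, 4, 5, 6]), (5, [2, 0, 1, 3, 4, 5, 6]), (5, [1, 0, 2, 3, 4, 5, 6]),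
     (5, [3, 0, 1, 2, 4, 5, 6]), (5, [1, 0, 2, 3, 4, 5, 6]), (5, [2, 0, 1, 3, 4, 5, 6]),
     (7, [0, 1, 3, 2, 5, 4, 6]), (1, [0, 1, 3, 2, 4, 5]), (1, [0, 2, 3, 1, 4, 5]),
     (0, [0, 4, 6, 3, 1, 2]), (7, [0, 1, 3, 2, 4, 5, 6]), (1, [0, 1, 3, 2, 5, 4]),
     (1, [0, 2, 3, 1, 5, 4]), (0, [0, 4, 5, 3, 1, 2]), (7, [0, 1, 3, 2, 4, 6, 5]),
     (6, [0, 1, 2, 4, 5, 6, 7]), (5, [1, 0, 2, 3, 4, 5, 6]), (5, [2, 0, 1, 3, 4, 5, 6]),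
     (9, [0, 4, 5, 1, 3, 2, 6, 7]), (8, [0, 4, 5, 1, 3, 2, 6, 7]), (8, [0, 5, 4, 1, 3, 2, 6, 7])]⟩,
  ⟨5, [(0, 1), (0, 2), (0, 3), (0, 4), (1, 2), (1, 3), (1, 4)],
    [(3, [0, 2, 1, 3, 4, 5]), (0, [0, 5, 2, 1, 3, 4]), (0, [0, 2, 5, 1, 3, 4]),
     (0, [0, 5, 3, 1, 2, 4]), (0, [0, 3, 5, 1, 2, 4]), (1, [0, 2, 1, 4, 5, 3]),
     (0, [0, 5, 4, 1, 2, 3]), (0, [0, 4, 5, 1, 2, 3]), (1, [0, 2, 1, 3, 5, 4]),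
     (1, [0, 3, 1, 2, 5, 4]), (6, [0, 1, 2, 5, 6, 3, 4]), (6, [1, 0, 2, 5, 6, 3, 4]),
     (5, [0, 2, 1, 3, 5, 6, 4]), (5, [0, 3, 1, 2, 5, 6, 4]), (5, [0, 4, 1, 2, 5, 6, 3])]⟩,
  ⟨5, [(0, 1), (0, 2), (0, 3), (0, 4), (1, 2), (1, 3), (2, 4)],
    [(0, [0, 4, 2, 1, 3, 5]), (0, [0, 3, 1, 2, 4, 5]), (15, [0, 1, 2, 3, 4, 5]),
     (1, [0, 1, 2, 4, 3, 5]), (1, [0, 1, 2, 4, 5, 3]), (0, [0, 3, 5, 2, 1, 4]),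
     (1, [0, 2, 1, 3, 4, 5]), (0, [0, 4, 5, 1, 2, 3]), (1, [0, 2, 1, 3, 5, 4]),
     (0, [1, 3, 5, 4, 0, 2]), (6, [0, 1, 2, 5, 6, 3, 4]), (5, [0, 1, 2, 4, 5, 6, 3]),
     (5, [0, 2, 1, 3, 5, 6, 4]), (5, [0, 3, 1, 2, 5, 6, 4]), (5, [0, 4, 2, 1, 5, 6, 3])]⟩,
  ⟨5, [(0, 1), (0, 2), (0, 3), (0, 4), (1, 2), (3, 4)],
    [(16, [0, 1, 2, 5, 3, 4]), (16, [0, 2, 1, 5, 3, 4]), (17, [0, 1, 2, 5, 3, 4]),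
     (16, [0, 3, 4, 5, 1, 2]), (15, [0, 1, 3, 2, 4, 5]), (15, [0, 2, 3, 1, 4, 5]),
     (16, [0, 4, 3, 5, 1, 2]), (15, [0, 1, 4, 2, 3, 5]), (15, [0, 2, 4, 1, 3, 5]),
     (17, [0, 3, 4, 5, 1, 2]), (6, [0, 1, 2, 3, 4, 5, 6]), (14, [0, 1, 2, 3, 4, 5, 6]),
     (14, [0, 2, 1, 3, 4, 5, 6]), (14, [0, 3, 4, 1, 2, 5, 6]), (14, [0, 4, 3, 1, 2, 5, 6])]⟩,
  ⟨4, [(0, 1), (0, 2), (0, 3), (1, 2), (1, 3)],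
    [(18, [0, 1, 2, 3, 4]), (19, [0, 1, 2, 3, 4]), (19, [1, 0, 2, 3, 4]), (19, [0, 1, 3, 2, 4]),
     (19, [1, 0, 3, 2, 4]), (18, [2, 3, 0, 1, 4]), (16, [0, 1, 2, 3, 4, 5]),
     (16, [1, 0, 2, 3, 4, 5]), (17, [2, 0, 1, 3, 4, 5]), (17, [3, 0, 1, 2, 4, 5])]⟩,
  ⟨3, [(0, 1), (0, 2), (1, 2)],
    [(21, [0, 1, 2, 3]), (21, [0, 2, 1, 3]), (21, [1, 2, 0, 3]), (20, [0, 1, 2, 3, 4]),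
     (20, [1, 0, 2, 3, 4]), (20, [2, 0, 1, 3, 4])]⟩]

theorem sixStages_covered : AllCovered sixExts patternGraphs sixStages := by decide +kernel

theorem triangleStages_covered : AllCovered growExts patternGraphs triangleStages := by
  decide +kernel

theorem sixStages_bounds : ∀ s ∈ sixStages, s.size = 5 ∨ s.size = 6 ∧ s.edges.length < 10 := by
  decide

theorem triangleStages_bounds : ∀ s ∈ triangleStages,
    0 < s.size ∧ s.size ≤ 7 ∧ (s.size = 7 → s.edges.length < 11) := by
  decide

theorem savesThree_of_card_eq_six {V : Type*} [Finite V] {G : SimpleGraph V} (hG : G.Connected)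
    (hcard : Nat.card V = 6) (hm : 10 ≤ G.edgeSet.ncard) : SavesThree G := by
  classical
  have := Fintype.ofFinite V
  obtain ⟨v, hv⟩ : ∃ v, 4 ≤ G.degree v := by
    by_contra! hlt
    have h1 := G.sum_degrees_eq_twice_card_edges
    have h2 : ∑ v, G.degree v ≤ ∑ _v : V, 3 :=
      Finset.sum_le_sum fun v _ => Nat.le_of_lt_succ (hlt v)
    rw [Finset.sum_const, Finset.card_univ, ← Nat.card_eq_fintype_card, hcard, smul_eq_mul] at h2
    rw [Set.ncard_eq_toFinset_card'] at hm
    change 10 ≤ G.edgeFinset.card at hm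
    omega
  obtain ⟨s, hs, hsize, hedges⟩ : ∃ s ∈ sixStages,
      s.size = 5 ∧ s.edges = [(0, 1), (0, 2), (0, 3), (0, 4)] := by decide
  refine sixStages_covered.savesThree (savesThree_of_mem_patternGraphs hG) ?_ s hs ?_
  · intro s hs h
    unfold sixExts
    obtain h5 | ⟨h6, hlen⟩ := sixStages_bounds s hs
    · rw [if_neg (by omega)]
      exact h.exists_pendantExts hG (by omega) (by omega)
    · rw [if_pos h6]
      exact h.exists_edgeExts (by omega) (by omega)
  · rw [hsize, hedges]
    have hlen : (G.neighborFinset v).toList.length = G.degree v := by simp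
    have hnodup : (v :: (G.neighborFinset v).toList).Nodup :=
      List.nodup_cons.2 ⟨by simp, Finset.nodup_toList _⟩
    have hlt : ∀ i < 5, i < (v :: (G.neighborFinset v).toList).length := by
      rw [List.length_cons]
      omega
    refine ⟨fun i => (v :: (G.neighborFinset v).toList).getD i v, fun i hi j hj hij => ?_, ?_⟩
    · dsimp only at hij
      rw [List.getD_eq_getElem _ _ (hlt i hi), List.getD_eq_getElem _ _ (hlt j hj)] at hij
      exact hnodup.getElem_inj_iff.1 hij
    · have hadj : ∀ i < 4, G.Adj v ((G.neighborFinset v).toList.getD i v) := by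
        intro i hi
        rw [List.getD_eq_getElem _ _ (by omega), ← mem_neighborFinset, ← Finset.mem_toList]
        exact List.getElem_mem _
      simpa using And.intro (hadj 0 (by simp)) (And.intro (hadj 1 (by simp))
        (And.intro (hadj 2 (by simp)) (hadj 3 (by simp))))

theorem savesThree_of_forall_adj_triangle {V : Type*} [Finite V] {G : SimpleGraph V}
    (hG : G.Connected) (htri : ∀ x y, G.Adj x y → ∃ z, G.Adj x z ∧ G.Adj y z)
    (hcard : 7 ≤ Nat.card V) (hm : Nat.card V + 4 ≤ G.edgeSet.ncard) : SavesThree G := by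
  obtain ⟨s, hs, hsize, hedges⟩ : ∃ s ∈ triangleStages,
      s.size = 3 ∧ s.edges = [(0, 1), (0, 2), (1, 2)] := by decide
  refine triangleStages_covered.savesThree (savesThree_of_mem_patternGraphs hG) ?_ s hs ?_
  · intro s hs h
    obtain ⟨hpos, hle, hlen⟩ := triangleStages_bounds s hs
    unfold growExts
    obtain heq | hlt := (hle.trans hcard).eq_or_lt
    · rw [if_pos (by omega)]
      have h7 := hlen (by omega)
      obtain ⟨e, he, heG⟩ := h.exists_edgeExts heq.symm (by omega)
      exact ⟨e, List.mem_append_left _ he, heG⟩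
    · obtain ⟨e, he, heG⟩ := h.exists_triangleExts hG htri hpos hlt
      exact ⟨e, List.mem_append_right _ he, heG⟩
  · rw [hsize, hedges]
    obtain ⟨e, he⟩ := Set.nonempty_of_ncard_ne_zero (s := G.edgeSet) (by omega)
    induction e with | _ x y
    rw [mem_edgeSet] at he
    obtain ⟨z, hxz, hyz⟩ := htri x y he
    refine ⟨fun i => [x, y, z].getD i x, fun i hi j hj hij => ?_, by simp [he, hxz, hyz]⟩
    have hnodup : [x, y, z].Nodup := by simp [he.ne, hxz.ne, hyz.ne]
    have hlen : [x, y, z].length = 3 := rfl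
    rw [Set.mem_Iio, ← hlen] at hi hj
    dsimp only at hij
    rw [List.getD_eq_getElem _ _ hi, List.getD_eq_getElem _ _ hj] at hij
    exact hnodup.getElem_inj_iff.1 hij

theorem savesThree_of_six_le_card.{u} {V : Type u} [Finite V] {G : SimpleGraph V}
    (hG : G.Connected) (hcard : 6 ≤ Nat.card V) (hm : Nat.card V + 4 ≤ G.edgeSet.ncard) :
    SavesThree G := by
  obtain ⟨n, hn⟩ : ∃ n, Nat.card V = n := ⟨_, rfl⟩
  induction n using Nat.strong_induction_on generalizing V with
  | _ n ih =>
  obtain h6 | h7 := hcard.eq_or_lt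
  · exact savesThree_of_card_eq_six hG h6.symm (by omega)
  by_cases htri : ∀ x y, G.Adj x y → ∃ z, G.Adj x z ∧ G.Adj y z
  · exact savesThree_of_forall_adj_triangle hG htri h7 hm
  push Not at htri
  obtain ⟨u, v, huv, huvw⟩ := htri
  have hV := card_eq_card_ne_add_one v
  have hedges := ncard_edgeSet_le_quotientGraph huv.ne huvw
  exact SavesThree.of_quotientGraph (φ := mergeInto u v huv.ne) huv hV (by omega)
    (fun a b => mergeInto_eq huv.ne)
    (ih _ (by omega) (quotientGraph_connected hG (mergeInto_surjective huv.ne)) (by omega)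
      (by omega) rfl)

/-- `x`, `y`, `z` is a path in `G` whose two edges have different colors. -/
def IsRainbowPath {V α : Type*} (G : SimpleGraph V) (c : Sym2 V → α) (x y z : V) : Prop :=
  G.Adj x y ∧ G.Adj y z ∧ c s(x, y) ≠ c s(y, z)

theorem IsRainbowPath.rainbowLinked {V α : Type*} {G : SimpleGraph V} {c : Sym2 V → α}
    {x y z : V} (h : IsRainbowPath G c x y z) {S : Finset V}
    (hS : ∀ w ∈ S, w = x ∨ w = y ∨ w = z) : RainbowLinked G c S := by
  obtain ⟨hxy, hyz, hc⟩ := h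
  let R : SimpleGraph V := fromEdgeSet {s(x, y), s(y, z)}
  have hR : R.edgeSet ⊆ {s(x, y), s(y, z)} := by
    simp only [R, edgeSet_fromEdgeSet]
    exact Set.sdiff_subset
  have hRxy : R.Adj x y := by simp [R, hxy.ne]
  have hRyz : R.Adj y z := by simp [R, hyz.ne]
  refine ⟨R, edgeSet_subset_edgeSet.1 (hR.trans ?_), ?_, ?_⟩
  · rintro e (rfl | rfl)
    exacts [hxy, hyz]
  · intro e he e' he' hee'
    rcases hR he with rfl | rfl <;> rcases hR he' with rfl | rfl
    exacts [rfl, (hc hee').elim, (hc hee'.symm).elim, rfl]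
  · have hy : ∀ w ∈ S, R.Reachable y w := by
      intro w hw
      obtain rfl | rfl | rfl := hS w hw
      exacts [hRxy.reachable.symm, Reachable.rfl, hRyz.reachable]
    exact fun a ha b hb => (hy a ha).symm.trans (hy b hb)

/-- With at most two colors, a rainbow tree through three vertices is a rainbow path on them. -/
theorem IsRainbowColoring.exists_isRainbowPath {V : Type*} [Fintype V] {G : SimpleGraph V} {q : ℕ}
    {c : Sym2 V → Fin q} (hc : IsRainbowColoring G c 3) (hq : q ≤ 2) {x y z : V} (hxy : x ≠ y)
    (hxz : x ≠ z) (hyz : y ≠ z) :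
    IsRainbowPath G c x y z ∨ IsRainbowPath G c y x z ∨ IsRainbowPath G c x z y := by
  classical
  obtain ⟨T, hST, hT, hinj⟩ := hc {x, y, z} (Finset.card_eq_three.2 ⟨x, y, z, hxy, hxz, hyz, rfl⟩)
  have hmaps : Set.InjOn (c ∘ Sym2.map Subtype.val) T.coe.edgeSet := by
    have hmem : ∀ e ∈ T.coe.edgeSet, Sym2.map Subtype.val e ∈ T.edgeSet := by
      intro e he
      induction e with | _ a b
      exact he
    intro e he e' he' hee'
    exact Sym2.map.injective Subtype.val_injective (hinj (hmem e he) (hmem e' he') hee')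
  have hedges : T.coe.edgeFinset.card ≤ 2 := by
    have := Finset.card_le_card_of_injOn (s := T.coe.edgeFinset) (t := Finset.univ)
      (c ∘ Sym2.map Subtype.val) (fun _ _ => Finset.mem_univ _) (by rwa [coe_edgeFinset])
    rw [Finset.card_univ, Fintype.card_fin] at this
    omega
  have hverts : T.verts = {x, y, z} := by
    have hcard := hT.card_edgeFinset
    refine (Set.eq_of_subset_of_ncard_le (s := {x, y, z}) (by simpa using hST) ?_
      (Set.toFinite _)).symm
    rw [Set.ncard_eq_three.2 ⟨x, y, z, hxy, hxz, hyz, rfl⟩, ← Nat.card_coe_set_eq,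
      Nat.card_eq_fintype_card]
    omega
  have hx : x ∈ T.verts := by simp [hverts]
  have hy : y ∈ T.verts := by simp [hverts]
  have hz : z ∈ T.verts := by simp [hverts]
  have hnbr : ∀ a ∈ T.verts, ∃ b ∈ T.verts, T.Adj a b := by
    intro a ha
    have : Nontrivial T.verts := ⟨⟨x, hx⟩, ⟨y, hy⟩, fun h => hxy (congrArg Subtype.val h)⟩
    obtain ⟨b, hb⟩ := hT.connected.preconnected.exists_adj_of_nontrivial ⟨a, ha⟩
    exact ⟨b, b.2, hb⟩
  have hpath : ∀ a b d, a ≠ d → T.Adj a b → T.Adj b d → IsRainbowPath G c a b d := by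
    intro a b d had hab hbd
    refine ⟨hab.adj_sub, hbd.adj_sub, fun h => had ?_⟩
    have := hinj (Subgraph.mem_edgeSet.2 hab) (Subgraph.mem_edgeSet.2 hbd) h
    grind
  obtain ⟨x', hx', hxx'⟩ := hnbr x hx
  obtain ⟨y', hy', hyy'⟩ := hnbr y hy
  obtain ⟨z', hz', hzz'⟩ := hnbr z hz
  rw [hverts, Set.mem_insert_iff, Set.mem_insert_iff, Set.mem_singleton_iff] at hx' hy' hz'
  have hirr : ∀ a, ¬ T.Adj a a := fun a h => h.ne rfl
  grind [Subgraph.Adj.symm]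

theorem k5MinusE_adj {x y : Fin 5} : K5MinusE.Adj x y ↔ x ≠ y ∧ s(x, y) ≠ s(0, 1) := by
  simp [K5MinusE, deleteEdges_adj]

instance : DecidableRel K5MinusE.Adj := fun _ _ => decidable_of_iff' _ k5MinusE_adj

/-- A 3-rainbow coloring of `K₅ - e` with three colors. -/
def k5Coloring (e : Sym2 (Fin 5)) : Fin 3 :=
  if e = s(2, 3) then 2
  else if e = s(0, 4) ∨ e = s(1, 2) ∨ e = s(1, 3) then 1 else 0

theorem isRainbowPath_k5Coloring (x y z : Fin 5) (hxy : x ≠ y) (hxz : x ≠ z) (hyz : y ≠ z) :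
    IsRainbowPath K5MinusE k5Coloring x y z ∨ IsRainbowPath K5MinusE k5Coloring y x z ∨
      IsRainbowPath K5MinusE k5Coloring x z y := by
  revert x y z
  unfold IsRainbowPath
  decide

theorem rxk_eq_three_of_iso {V : Type*} [Fintype V] {G : SimpleGraph V} (φ : G ≃g K5MinusE) :
    rxk G 3 = 3 := by
  have hthree : 3 ∈ {q | ∃ c : Sym2 V → Fin q, IsRainbowColoring G c 3} := by
    refine ⟨k5Coloring ∘ Sym2.map φ, fun S hS => RainbowLinked.exists_tree ?_
      (Finset.card_pos.1 (by omega))⟩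
    classical
    obtain ⟨x, y, z, hxy, hxz, hyz, rfl⟩ := Finset.card_eq_three.1 hS
    have hlift : ∀ {a b d}, IsRainbowPath K5MinusE k5Coloring (φ a) (φ b) (φ d) →
        IsRainbowPath G (k5Coloring ∘ Sym2.map φ) a b d :=
      fun ⟨h1, h2, h3⟩ => ⟨φ.map_adj_iff.1 h1, φ.map_adj_iff.1 h2, h3⟩
    obtain h | h | h := isRainbowPath_k5Coloring (φ x) (φ y) (φ z) (φ.injective.ne hxy)
      (φ.injective.ne hxz) (φ.injective.ne hyz)
    all_goals
      refine (hlift h).rainbowLinked fun w hw => ?_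
      simp only [Finset.mem_insert, Finset.mem_singleton] at hw
      tauto
  refine le_antisymm (Nat.sInf_le hthree) (le_csInf ⟨3, hthree⟩ ?_)
  rintro q ⟨c, hc⟩
  by_contra! hq
  let d (i j : Fin 5) : ℕ := c s(φ.symm i, φ.symm j)
  have hlt : ∀ i j, d i j < 2 := fun i j => (c _).2.trans_le (Nat.le_of_lt_succ hq)
  have hcomm : ∀ i j, d i j = d j i := fun i j => by simp only [d, Sym2.eq_swap]
  have hpath : ∀ i j k, i ≠ j → i ≠ k → j ≠ k →
      (K5MinusE.Adj i j ∧ d i j ≠ d j k) ∨ (K5MinusE.Adj j i ∧ d j i ≠ d i k) ∨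
        (K5MinusE.Adj k j ∧ d i k ≠ d k j) := by
    intro i j k hij hik hjk
    have := hc.exists_isRainbowPath (Nat.le_of_lt_succ hq) (φ.symm.injective.ne hij)
      (φ.symm.injective.ne hik) (φ.symm.injective.ne hjk)
    simp only [IsRainbowPath, φ.symm.map_adj_iff, ne_eq, Fin.ext_iff] at this
    tauto
  have hside : ∀ i, 0 ≠ i → 1 ≠ i → d 0 i ≠ d 1 i := by
    intro i h0 h1
    have hnadj : ¬ K5MinusE.Adj 0 1 ∧ ¬ K5MinusE.Adj 1 0 := by decide
    have := hpath 0 1 i (by decide) h0 h1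
    rw [hcomm i 1] at this
    tauto
  have htriangle : ∀ i j k, i ≠ j → i ≠ k → j ≠ k → ¬ (d i j = d i k ∧ d i j = d j k) := by
    intro i j k hij hik hjk
    have := hpath i j k hij hik hjk
    rw [hcomm j i, hcomm k j] at this
    omega
  have hne : ∀ i j, 0 ≠ i → 1 ≠ i → 0 ≠ j → 1 ≠ j → i ≠ j → d 0 i ≠ d 0 j := by
    intro i j h0i h1i h0j h1j hij
    have := htriangle 0 i j h0i h0j hij
    have := htriangle 1 i j h1i h1j hij
    have := hside i h0i h1i
    have := hside j h0j h1j
    have := hlt 0 i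
    have := hlt 0 j
    have := hlt 1 i
    have := hlt 1 j
    have := hlt i j
    omega
  have h23 := hne 2 3 (by decide) (by decide) (by decide) (by decide) (by decide)
  have h24 := hne 2 4 (by decide) (by decide) (by decide) (by decide) (by decide)
  have h34 := hne 3 4 (by decide) (by decide) (by decide) (by decide) (by decide)
  have := hlt 0 2
  have := hlt 0 3
  have := hlt 0 4
  omega

theorem nonempty_iso_k5MinusE {V : Type*} [Fintype V] {G : SimpleGraph V}
    (hcard : Fintype.card V = 5) (hm : G.edgeSet.ncard = 9) : Nonempty (G ≃g K5MinusE) := by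
  classical
  have htop : (⊤ : SimpleGraph V).edgeSet.ncard = 10 := by
    rw [Set.ncard_eq_toFinset_card']
    change (⊤ : SimpleGraph V).edgeFinset.card = 10
    rw [card_edgeFinset_top_eq_card_choose_two, hcard]
    rfl
  have hdiff : ((⊤ : SimpleGraph V).edgeSet \ G.edgeSet).ncard = 1 := by
    rw [Set.ncard_sdiff (edgeSet_subset_edgeSet.2 le_top) (Set.toFinite _), htop, hm]
  obtain ⟨e, he⟩ := Set.ncard_eq_one.1 hdiff
  induction e with | _ a b
  have hab : a ≠ b := by
    have : s(a, b) ∈ (⊤ : SimpleGraph V).edgeSet \ G.edgeSet := he ▸ rfl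
    exact (mem_edgeSet _).1 this.1
  have hadj : ∀ x y, G.Adj x y ↔ x ≠ y ∧ s(x, y) ≠ s(a, b) := by
    intro x y
    have := Set.ext_iff.1 he s(x, y)
    simp only [Set.mem_sdiff, mem_edgeSet, top_adj, Set.mem_singleton_iff] at this
    have := fun h : G.Adj x y => h.ne
    tauto
  obtain ⟨ψ, ha, hb⟩ : ∃ ψ : V ≃ Fin 5, ψ a = 0 ∧ ψ b = 1 := by
    let e := Fintype.equivFinOfCardEq hcard
    let σ := e.trans (Equiv.swap (e a) 0)
    have hσa : σ a = 0 := Equiv.swap_apply_left _ _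
    have hσb : σ b ≠ 0 := hσa ▸ σ.injective.ne hab.symm
    refine ⟨σ.trans (Equiv.swap (σ b) 1), ?_, Equiv.swap_apply_left _ _⟩
    rw [Equiv.trans_apply, hσa, Equiv.swap_apply_of_ne_of_ne hσb.symm (by decide)]
  refine ⟨ψ, fun {x y} => ?_⟩
  rw [k5MinusE_adj, hadj, ← ha, ← hb, ψ.injective.ne_iff, ← Sym2.map_mk, ← Sym2.map_mk,
    (Sym2.map.injective ψ.injective).ne_iff]

theorem five_le_card_of_ncard_edgeSet {V : Type*} [Fintype V] {G : SimpleGraph V}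
    (hm : G.edgeSet.ncard = Fintype.card V + 4) : 5 ≤ Fintype.card V := by
  classical
  by_contra! hlt
  have hle := G.card_edgeFinset_le_card_choose_two
  rw [Set.ncard_eq_toFinset_card'] at hm
  change G.edgeFinset.card = _ at hm
  rw [hm] at hle
  interval_cases Fintype.card V <;> simp [Nat.choose] at hle

theorem stmt_16 {V : Type*} [Fintype V] (G : SimpleGraph V) (hG : G.Connected)
    (h5cyclic : G.edgeSet.ncard = Fintype.card V + 4) :
    rxk G 3 = Fintype.card V - 2 ↔ Nonempty (G ≃g K5MinusE) := by
  constructor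
  · intro h
    obtain h5 | h6 := (five_le_card_of_ncard_edgeSet h5cyclic).eq_or_lt
    · exact nonempty_iso_k5MinusE h5.symm (by omega)
    · have hcard := Nat.card_eq_fintype_card (α := V)
      have := (savesThree_of_six_le_card hG (by omega) (by omega)).rxk_le
      omega
  · rintro ⟨φ⟩
    rw [rxk_eq_three_of_iso φ, Fintype.card_congr φ.toEquiv, Fintype.card_fin]
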